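/- Let α ≥ 1 be an integer. Define a_0 = 1 and a_j = 2(α-j) a_{j-1} for 1 ≤ j ≤ α-1, and for z, w > 0 set P(z,w) = (α/2^{2α-2}) Σ_{j=0}^{α-1} a_j T_j(z,w), where T_j(z,w) = Σ_{q=⌈j/2⌉}^{j} Σ_{r=0}^{2q-j} C(2q-j, r) · (-1)^j (2α)! (α-q)! j! / ((2α-2q)! α! (2q-j)! (j-q)!) · 2^r w^{2r} (z^2-w^2)^{2α-j-r-1} / (z^{2α} w^{2α}). Then for every fixed w > 0 the function z ↦ P(z,w) satisfies, for all z > 0 with z ≠ w, z ∂_z^2 P(z,w) + (2α+1) ∂_z P(z,w) + z P(z,w) = (α/(2^{2α-2} w^{2α})) ((z^2-w^2)/z)^{2α-1}. -/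

import Mathlib

/-- The coefficients `a_0 = 1`, `a_j = 2(α-j) a_{j-1}`. -/
noncomputable def aCoef (α : ℕ) : ℕ → ℝ
  | 0 => 1
  | j + 1 => 2 * ((α : ℝ) - (j + 1)) * aCoef α j

/-- The inner double sum `T_j(z,w)` appearing in the Nicholson-type formula. -/
noncomputable def nicholsonT (α j : ℕ) (z w : ℝ) : ℝ :=
  ∑ q ∈ Finset.Icc ((j + 1) / 2) j, ∑ r ∈ Finset.range (2 * q - j + 1),
    (Nat.choose (2 * q - j) r : ℝ) *
      ((-1 : ℝ) ^ j *
        ((Nat.factorial (2 * α) : ℝ) * (Nat.factorial (α - q) : ℝ) *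
            (Nat.factorial j : ℝ)) /
          ((Nat.factorial (2 * α - 2 * q) : ℝ) * (Nat.factorial α : ℝ) *
            (Nat.factorial (2 * q - j) : ℝ) * (Nat.factorial (j - q) : ℝ))) *
      (2 : ℝ) ^ r * w ^ (2 * r) * (z ^ 2 - w ^ 2) ^ (2 * α - j - r - 1) /
      (z ^ (2 * α) * w ^ (2 * α))

/-- The polynomial part `P(z,w) = (α/2^{2α-2}) Σ_{j=0}^{α-1} a_j T_j(z,w)`. -/
noncomputable def nicholsonP (α : ℕ) (z w : ℝ) : ℝ :=
  ((α : ℝ) / (2 : ℝ) ^ (2 * (α : ℤ) - 2)) *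
    ∑ j ∈ Finset.range α, aCoef α j * nicholsonT α j z w

/-- `h = x f'' + c f'` on `x > 0`, `x² ≠ y`, where `f` is twice differentiable. -/
def HasBesselOp (c y : ℝ) (f h : ℝ → ℝ) : Prop :=
  ∃ f' f'' : ℝ → ℝ, ∀ x : ℝ, 0 < x → x ^ 2 ≠ y →
    HasDerivAt f (f' x) x ∧ HasDerivAt f' (f'' x) x ∧ x * f'' x + c * f' x = h x

theorem HasBesselOp.const_mul {c y : ℝ} {f h : ℝ → ℝ} (hf : HasBesselOp c y f h) (k : ℝ) :
    HasBesselOp c y (fun x => k * f x) (fun x => k * h x) := by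
  obtain ⟨f', f'', H⟩ := hf
  refine ⟨fun x => k * f' x, fun x => k * f'' x, fun x hx hxy => ?_⟩
  obtain ⟨h1, h2, h3⟩ := H x hx hxy
  exact ⟨h1.const_mul k, h2.const_mul k, by linear_combination k * h3⟩

theorem HasBesselOp.sum {c y : ℝ} {ι : Type*} (s : Finset ι) {f h : ι → ℝ → ℝ}
    (hf : ∀ i ∈ s, HasBesselOp c y (f i) (h i)) :
    HasBesselOp c y (fun x => ∑ i ∈ s, f i x) (fun x => ∑ i ∈ s, h i x) := by
  classical
  induction s using Finset.induction_on with
  | empty =>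
    exact ⟨fun _ => 0, fun _ => 0, fun x _ _ =>
      ⟨hasDerivAt_const x (0 : ℝ), hasDerivAt_const x (0 : ℝ), by simp⟩⟩
  | insert a s ha ih =>
    obtain ⟨f', f'', H⟩ := hf a (Finset.mem_insert_self a s)
    obtain ⟨g', g'', G⟩ := ih fun i hi => hf i (Finset.mem_insert_of_mem hi)
    simp only [Finset.sum_insert ha]
    refine ⟨fun x => f' x + g' x, fun x => f'' x + g'' x, fun x hx hxy => ?_⟩
    obtain ⟨h1, h2, h3⟩ := H x hx hxy
    obtain ⟨g1, g2, g3⟩ := G x hx hxy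
    exact ⟨h1.add g1, h2.add g2, by linear_combination h3 + g3⟩

/-- The monomial `x^n (x²+y)^a (x²-y)^b` with integer exponents. -/
noncomputable def bilinMonomial (y : ℝ) (n a b : ℤ) (x : ℝ) : ℝ :=
  x ^ n * (x ^ 2 + y) ^ a * (x ^ 2 - y) ^ b

theorem hasDerivAt_bilinMonomial {y : ℝ} (hy : 0 < y) (n a b : ℤ) {x : ℝ} (hx : 0 < x)
    (hxy : x ^ 2 ≠ y) :
    HasDerivAt (bilinMonomial y n a b)
      (n * bilinMonomial y (n - 1) a b x + 2 * a * bilinMonomial y (n + 1) (a - 1) b x +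
        2 * b * bilinMonomial y (n + 1) a (b - 1) x) x := by
  have hu : x ^ 2 + y ≠ 0 := by positivity
  have hv : x ^ 2 - y ≠ 0 := sub_ne_zero.mpr hxy
  have h1 := hasDerivAt_zpow n x (Or.inl hx.ne')
  have h2 := (hasDerivAt_zpow a (x ^ 2 + y) (Or.inl hu)).comp x
    (((hasDerivAt_id x).pow 2).add_const y)
  have h3 := (hasDerivAt_zpow b (x ^ 2 - y) (Or.inl hv)).comp x
    (((hasDerivAt_id x).pow 2).sub_const y)
  refine ((h1.mul h2).mul h3).congr_deriv ?_
  simp only [bilinMonomial, zpow_add_one₀ hx.ne', Function.comp_apply, Pi.mul_apply,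
    Pi.pow_apply, id_eq]
  push_cast
  ring

theorem hasBesselOp_bilinMonomial {y : ℝ} (hy : 0 < y) (α j q : ℕ) :
    HasBesselOp (2 * (α : ℝ) + 1) y (bilinMonomial y (-(2 * α)) (2 * q - j) (2 * α - 1 - 2 * q))
      (fun x => 4 * x ^ (1 - 2 * α : ℤ) *
        ((2 * q - j : ℝ) * (α - q - (j + 1) / 2) *
            ((x ^ 2 + y) ^ (2 * q - j - 1 : ℤ) * (x ^ 2 - y) ^ (2 * α - 1 - 2 * q : ℤ)) +
          (2 * α - 1 - 2 * q : ℝ) * (q - j) *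
            ((x ^ 2 + y) ^ (2 * q - j : ℤ) * (x ^ 2 - y) ^ (2 * α - 2 - 2 * q : ℤ)) +
          (2 * q - j : ℝ) * (2 * q - j - 1) / 2 *
            ((x ^ 2 + y) ^ (2 * q - j - 2 : ℤ) * (x ^ 2 - y) ^ (2 * α - 2 * q : ℤ)) +
          (2 * α - 1 - 2 * q : ℝ) * (2 * α - 2 - 2 * q) / 2 *
            ((x ^ 2 + y) ^ (2 * q - j + 1 : ℤ) * (x ^ 2 - y) ^ (2 * α - 3 - 2 * q : ℤ)))) := by
  refine ⟨_, _, fun x hx hxy => ⟨hasDerivAt_bilinMonomial hy _ _ _ hx hxy,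
    (((hasDerivAt_bilinMonomial hy _ _ _ hx hxy).const_mul _).add
      ((hasDerivAt_bilinMonomial hy _ _ _ hx hxy).const_mul _)).add
      ((hasDerivAt_bilinMonomial hy _ _ _ hx hxy).const_mul _), ?_⟩⟩
  have hu : x ^ 2 + y ≠ 0 := by positivity
  have hv : x ^ 2 - y ≠ 0 := sub_ne_zero.mpr hxy
  have hx0 := hx.ne'
  have e1 : (2 * α - 2 - 2 * q : ℤ) = 2 * α - 1 - 2 * q - 1 := by ring
  have e2 : (2 * α - 2 * q : ℤ) = 2 * α - 1 - 2 * q + 1 := by ring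
  have e3 : (2 * α - 3 - 2 * q : ℤ) = 2 * α - 1 - 2 * q - 1 - 1 := by ring
  have e4 : (2 * q - j - 2 : ℤ) = 2 * q - j - 1 - 1 := by ring
  have e5 : (1 - 2 * α : ℤ) = -(2 * α) + 1 := by ring
  rw [e1, e2, e3, e4, e5]
  simp only [bilinMonomial, zpow_add_one₀ hx0, zpow_sub_one₀ hx0, zpow_add_one₀ hu,
    zpow_sub_one₀ hu, zpow_add_one₀ hv, zpow_sub_one₀ hv]
  push_cast
  generalize x ^ (-(2 * α) : ℤ) = X
  generalize (x ^ 2 + y) ^ (2 * q - j : ℤ) = U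
  generalize (x ^ 2 - y) ^ (2 * α - 1 - 2 * q : ℤ) = V
  field_simp
  ring

/-- The coefficient of `(z²+w²)^(2q-j) (z²-w²)^(2α-1-2q)` in `z^(2α) w^(2α) T_j(z,w)`. -/
noncomputable def nicholsonCoef (α j q : ℕ) : ℝ :=
  if j ≤ 2 * q ∧ q ≤ j then
    (-1 : ℝ) ^ j *
        ((Nat.factorial (2 * α) : ℝ) * (Nat.factorial (α - q) : ℝ) *
            (Nat.factorial j : ℝ)) /
          ((Nat.factorial (2 * α - 2 * q) : ℝ) * (Nat.factorial α : ℝ) *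
            (Nat.factorial (2 * q - j) : ℝ) * (Nat.factorial (j - q) : ℝ))
  else 0

theorem nicholsonCoef_of_not {α j q : ℕ} (h : ¬ (j ≤ 2 * q ∧ q ≤ j)) :
    nicholsonCoef α j q = 0 := if_neg h

theorem nicholsonCoef_add (p m k : ℕ) :
    nicholsonCoef (m + k + p) (m + 2 * k) (m + k) =
      (-1 : ℝ) ^ m * ((2 * (m + k + p)).factorial * p.factorial * (m + 2 * k).factorial) /
        ((2 * p).factorial * (m + k + p).factorial * m.factorial * k.factorial) := by
  rw [nicholsonCoef, if_pos (by omega), pow_add, pow_mul]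
  have h1 : m + k + p - (m + k) = p := by omega
  have h2 : 2 * (m + k + p) - 2 * (m + k) = 2 * p := by omega
  have h3 : 2 * (m + k) - (m + 2 * k) = m := by omega
  have h4 : m + 2 * k - (m + k) = k := by omega
  rw [h1, h2, h3, h4]
  norm_num

theorem nicholsonCoef_eq {α j q : ℕ} (p m k : ℕ) (hα : α = m + k + p) (hj : j = m + 2 * k)
    (hq : q = m + k) :
    nicholsonCoef α j q =
      (-1 : ℝ) ^ m * ((2 * α).factorial * p.factorial * j.factorial) /
        ((2 * p).factorial * α.factorial * m.factorial * k.factorial) := by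
  subst hα hj hq
  exact nicholsonCoef_add p m k

theorem nicholsonCoef_succ_right {α j q : ℕ} (hq : q + 1 ≤ α) :
    nicholsonCoef α j (q + 1) * ((2 * (q + 1) - j) * (2 * (q + 1) - j - 1) / 2) +
      nicholsonCoef α j q * ((2 * α - 1 - 2 * q) * (q - j)) = 0 := by
  by_cases h1 : j ≤ 2 * q ∧ q + 1 ≤ j
  · obtain ⟨k, rfl⟩ := Nat.exists_eq_add_of_le h1.2
    obtain ⟨m, rfl⟩ : ∃ m, q = m + (k + 1) := ⟨q - (k + 1), by omega⟩
    obtain ⟨p, rfl⟩ := Nat.exists_eq_add_of_le hq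
    rw [nicholsonCoef_eq p (m + 2) k (by ring) (by ring) (by ring),
      nicholsonCoef_eq (p + 1) m (k + 1) (by ring) (by ring) (by ring)]
    rw [show 2 * (p + 1) = 2 * p + 1 + 1 by ring]
    simp only [Nat.factorial_succ m, Nat.factorial_succ (m + 1), Nat.factorial_succ k,
      Nat.factorial_succ p, Nat.factorial_succ (2 * p), Nat.factorial_succ (2 * p + 1)]
    push_cast
    field_simp
    ring
  · by_cases h2 : q = j
    · subst h2
      rw [nicholsonCoef_of_not (q := q + 1) (by omega)]
      ring
    · rw [nicholsonCoef_of_not (q := q) (by omega)]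
      by_cases h3 : j = 2 * q + 1
      · subst h3; push_cast; ring
      · by_cases h4 : j = 2 * (q + 1)
        · subst h4; push_cast; ring
        · rw [nicholsonCoef_of_not (by omega)]; ring

theorem nicholsonCoef_succ_succ {α j q : ℕ} (hq : q + 2 ≤ α) :
    nicholsonCoef α j (q + 1) * ((2 * (q + 1) - j) * (α - (q + 1) - (j + 1) / 2)) +
      nicholsonCoef α j q * ((2 * α - 1 - 2 * q) * (2 * α - 2 - 2 * q) / 2) =
      -((α - 1 - j) / 2) * nicholsonCoef α (j + 1) (q + 1) := by
  obtain ⟨p, rfl⟩ := Nat.exists_eq_add_of_le hq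
  by_cases h1 : j ≤ 2 * q + 1 ∧ q ≤ j
  · rcases Nat.eq_or_lt_of_le h1.2 with h2 | h2
    · subst h2
      rw [nicholsonCoef_of_not (j := q) (q := q + 1) (by omega),
        nicholsonCoef_eq (p + 2) q 0 (by ring) (by ring) (by ring),
        nicholsonCoef_eq (p + 1) (q + 1) 0 (by ring) (by ring) (by ring)]
      rw [show 2 * (p + 2) = 2 * p + 1 + 1 + 1 + 1 by ring,
        show 2 * (p + 1) = 2 * p + 1 + 1 by ring]
      simp only [Nat.factorial_succ q, Nat.factorial_succ (p + 1), Nat.factorial_succ (2 * p + 1),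
        Nat.factorial_succ (2 * p + 1 + 1), Nat.factorial_succ (2 * p + 1 + 1 + 1)]
      push_cast
      field_simp
      ring
    · obtain ⟨k, rfl⟩ := Nat.exists_eq_add_of_lt h2
      rcases Nat.eq_or_lt_of_le h1.1 with h3 | h3
      · obtain rfl : k = q := by omega
        rw [nicholsonCoef_of_not (q := k) (by omega),
          nicholsonCoef_eq (p + 1) 1 k (by ring) (by ring) (by ring),
          nicholsonCoef_eq (p + 1) 0 (k + 1) (by ring) (by ring) (by ring)]
        simp only [Nat.factorial_succ k, Nat.factorial_succ (k + k + 1)]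
        push_cast
        field_simp
        ring
      · obtain ⟨m, rfl⟩ : ∃ m, q = m + (k + 1) := ⟨q - (k + 1), by omega⟩
        rw [nicholsonCoef_eq (p + 1) (m + 2) k (by ring) (by ring) (by ring),
          nicholsonCoef_eq (p + 2) m (k + 1) (by ring) (by ring) (by ring),
          nicholsonCoef_eq (p + 1) (m + 1) (k + 1) (by ring) (by ring) (by ring)]
        rw [show 2 * (p + 2) = 2 * p + 1 + 1 + 1 + 1 by ring,
          show 2 * (p + 1) = 2 * p + 1 + 1 by ring]
        simp only [Nat.factorial_succ k, Nat.factorial_succ m, Nat.factorial_succ (m + 1),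
          Nat.factorial_succ (p + 1), Nat.factorial_succ (2 * p + 1),
          Nat.factorial_succ (2 * p + 1 + 1), Nat.factorial_succ (2 * p + 1 + 1 + 1),
          Nat.factorial_succ (m + (k + 1) + k + 1)]
        push_cast
        field_simp
        ring
  · rw [nicholsonCoef_of_not (j := j + 1) (by omega), nicholsonCoef_of_not (q := q) (by omega)]
    by_cases h4 : j = 2 * (q + 1)
    · subst h4; push_cast; ring
    · rw [nicholsonCoef_of_not (by omega)]; ring

theorem nicholsonCoef_zero_mul (α j : ℕ) : nicholsonCoef α j 0 * j = 0 := by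
  rcases Nat.eq_zero_or_pos j with rfl | h
  · simp
  · rw [nicholsonCoef_of_not (by omega), zero_mul]

/-- `T_j`, up to the factor `w^(-2α)`, as a combination of monomials in `z`, `z² + w²` and
`z² - w²`. -/
noncomputable def nicholsonSum (α j : ℕ) (y x : ℝ) : ℝ :=
  ∑ q ∈ Finset.range α,
    nicholsonCoef α j q * bilinMonomial y (-(2 * α)) (2 * q - j) (2 * α - 1 - 2 * q) x

theorem nicholsonT_eq {α j : ℕ} (hj : j < α) {w x : ℝ} (hw : 0 < w) (hx : 0 < x)
    (hxy : x ^ 2 ≠ w ^ 2) :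
    nicholsonT α j x w = nicholsonSum α j (w ^ 2) x / w ^ (2 * α) := by
  have hv : x ^ 2 - w ^ 2 ≠ 0 := sub_ne_zero.mpr hxy
  rw [nicholsonT, nicholsonSum, Finset.sum_div]
  have hsub : Finset.Icc ((j + 1) / 2) j ⊆ Finset.range α := fun q hq => by
    simp only [Finset.mem_Icc, Finset.mem_range] at *
    omega
  rw [← Finset.sum_subset hsub fun q _ hq => by
    rw [nicholsonCoef_of_not (by simp only [Finset.mem_Icc] at hq; omega)]; simp]
  refine Finset.sum_congr rfl fun q hq => ?_
  rw [Finset.mem_Icc] at hq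
  have hz : (x ^ (2 * α))⁻¹ = x ^ (-(2 * α) : ℤ) := by
    rw [zpow_neg]; norm_cast
  have hu : (x ^ 2 + w ^ 2) ^ (2 * q - j : ℤ) =
      ∑ r ∈ Finset.range (2 * q - j + 1),
        (2 * w ^ 2) ^ r * (x ^ 2 - w ^ 2) ^ (2 * q - j - r) * ((2 * q - j).choose r : ℝ) := by
    rw [← add_pow, show (2 * q - j : ℤ) = (2 * q - j : ℕ) by omega, zpow_natCast]
    congr 1
    ring
  rw [nicholsonCoef, if_pos (by omega), bilinMonomial, hu, ← hz]
  simp only [Finset.mul_sum, Finset.sum_mul, Finset.sum_div]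
  refine Finset.sum_congr rfl fun r hr => ?_
  rw [Finset.mem_range] at hr
  have hb : (x ^ 2 - w ^ 2) ^ (2 * α - 1 - 2 * q : ℤ) = (x ^ 2 - w ^ 2) ^ (2 * α - 1 - 2 * q) := by
    rw [show (2 * α - 1 - 2 * q : ℤ) = (2 * α - 1 - 2 * q : ℕ) by omega, zpow_natCast]
  rw [hb, show 2 * α - j - r - 1 = (2 * q - j - r) + (2 * α - 1 - 2 * q) by omega, pow_add,
    mul_pow, ← pow_mul]
  field_simp

theorem hasBesselOp_nicholsonSum {y : ℝ} (hy : 0 < y) {α j : ℕ} (hj : j < α) :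
    HasBesselOp (2 * (α : ℝ) + 1) y (nicholsonSum α j y)
      (fun x => -(2 * ((α : ℝ) - (j + 1))) * (x * nicholsonSum α (j + 1) y x)) := by
  obtain ⟨f', f'', H⟩ := HasBesselOp.sum (Finset.range α) fun q _ =>
    (hasBesselOp_bilinMonomial hy α j q).const_mul (nicholsonCoef α j q)
  refine ⟨f', f'', fun x hx hxy => ?_⟩
  obtain ⟨h1, h2, h3⟩ := H x hx hxy
  refine ⟨h1, h2, h3.trans ?_⟩
  clear h1 h2 h3 H
  obtain ⟨n, rfl⟩ : ∃ n, α = n + 1 := ⟨α - 1, by omega⟩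
  have hxz : x ^ (1 - 2 * (n + 1 : ℕ) : ℤ) = x * x ^ (-(2 * (n + 1 : ℕ)) : ℤ) := by
    rw [sub_eq_add_neg, zpow_add₀ hx.ne', zpow_one]
  set u := x ^ 2 + y with hu
  set v := x ^ 2 - y with hv
  let c := nicholsonCoef (n + 1) j
  let A : ℕ → ℝ := fun q => c q * ((2 * q - j : ℝ) * ((n + 1 : ℕ) - q - (j + 1) / 2)) *
    (u ^ (2 * q - j - 1 : ℤ) * v ^ (2 * (n + 1 : ℕ) - 1 - 2 * q : ℤ))
  let B : ℕ → ℝ := fun q => c q * ((2 * (n + 1 : ℕ) - 1 - 2 * q : ℝ) * (q - j)) *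
    (u ^ (2 * q - j : ℤ) * v ^ (2 * (n + 1 : ℕ) - 2 - 2 * q : ℤ))
  let C : ℕ → ℝ := fun q => c q * ((2 * q - j : ℝ) * (2 * q - j - 1) / 2) *
    (u ^ (2 * q - j - 2 : ℤ) * v ^ (2 * (n + 1 : ℕ) - 2 * q : ℤ))
  let E : ℕ → ℝ := fun q =>
    c q * ((2 * (n + 1 : ℕ) - 1 - 2 * q : ℝ) * (2 * (n + 1 : ℕ) - 2 - 2 * q) / 2) *
    (u ^ (2 * q - j + 1 : ℤ) * v ^ (2 * (n + 1 : ℕ) - 3 - 2 * q : ℤ))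
  let G : ℕ → ℝ := fun q => nicholsonCoef (n + 1) (j + 1) q *
    (u ^ (2 * q - (j + 1 : ℕ) : ℤ) * v ^ (2 * (n + 1 : ℕ) - 1 - 2 * q : ℤ))
  have c0 : c 0 * j = 0 := nicholsonCoef_zero_mul _ _
  have hBC : ∑ q ∈ Finset.range (n + 1), B q + ∑ q ∈ Finset.range (n + 1), C q = 0 := by
    have hB : B n = 0 := by
      have : c n * ((n : ℝ) - j) = 0 := by
        rcases Nat.eq_or_lt_of_le (Nat.le_of_lt_succ hj) with h | h
        · rw [h]; ring
        · rw [show c n = 0 from nicholsonCoef_of_not (by omega), zero_mul]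
      simp only [B]
      linear_combination (2 * (n + 1 : ℕ) - 1 - 2 * n : ℝ) *
        (u ^ (2 * n - j : ℤ) * v ^ (2 * (n + 1 : ℕ) - 2 - 2 * n : ℤ)) * this
    have hC : C 0 = 0 := by
      simp only [C]
      generalize u ^ (2 * (0 : ℕ) - j - 2 : ℤ) * v ^ (2 * (n + 1 : ℕ) - 2 * (0 : ℕ) : ℤ) = X
      push_cast
      linear_combination (j + 1) / 2 * X * c0
    rw [Finset.sum_range_succ, Finset.sum_range_succ' C, hB, hC, add_zero, add_zero,
      ← Finset.sum_add_distrib]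
    refine Finset.sum_eq_zero fun q hq => ?_
    have hq' := Finset.mem_range.mp hq
    have key := nicholsonCoef_succ_right (α := n + 1) (j := j) (q := q) (by omega)
    simp only [B, C]
    rw [show (2 * (q + 1 : ℕ) - j - 2 : ℤ) = 2 * q - j by push_cast; ring,
      show (2 * (n + 1 : ℕ) - 2 * (q + 1 : ℕ) : ℤ) = 2 * (n + 1 : ℕ) - 2 - 2 * q by
        push_cast; ring]
    push_cast at key ⊢
    linear_combination (u ^ (2 * q - j : ℤ) * v ^ (2 * (n + 1) - 2 - 2 * q : ℤ)) * key
  have hAE : ∑ q ∈ Finset.range (n + 1), A q + ∑ q ∈ Finset.range (n + 1), E q =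
      -(((n + 1 : ℕ) - 1 - j) / 2) * ∑ q ∈ Finset.range (n + 1), G q := by
    have hE : E n = 0 := by
      simp only [E]
      push_cast
      ring
    have hA : A 0 = 0 := by
      simp only [A]
      generalize u ^ (2 * (0 : ℕ) - j - 1 : ℤ) * v ^ (2 * (n + 1 : ℕ) - 1 - 2 * (0 : ℕ) : ℤ) = X
      push_cast
      linear_combination -((n + 1 - 0 - (j + 1) / 2) : ℝ) * X * c0
    have hG : G 0 = 0 := by
      simp only [G]
      rw [nicholsonCoef_of_not (by omega), zero_mul]
    rw [Finset.sum_range_succ E, Finset.sum_range_succ' A, Finset.sum_range_succ' G, hE, hA, hG,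
      add_zero, add_zero, add_zero, ← Finset.sum_add_distrib, Finset.mul_sum]
    refine Finset.sum_congr rfl fun q hq => ?_
    have hq' := Finset.mem_range.mp hq
    have key := nicholsonCoef_succ_succ (α := n + 1) (j := j) (q := q) (by omega)
    simp only [A, E, G]
    rw [show (2 * (q + 1 : ℕ) - j - 1 : ℤ) = 2 * q - j + 1 by push_cast; ring,
      show (2 * (q + 1 : ℕ) - (j + 1 : ℕ) : ℤ) = 2 * q - j + 1 by push_cast; ring,
      show (2 * (n + 1 : ℕ) - 1 - 2 * (q + 1 : ℕ) : ℤ) = 2 * (n + 1 : ℕ) - 3 - 2 * q by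
        push_cast; ring]
    push_cast at key ⊢
    linear_combination (u ^ (2 * q - j + 1 : ℤ) * v ^ (2 * (n + 1) - 3 - 2 * q : ℤ)) * key
  have hS : nicholsonSum (n + 1) (j + 1) y x =
      x ^ (-(2 * (n + 1 : ℕ)) : ℤ) * ∑ q ∈ Finset.range (n + 1), G q := by
    rw [nicholsonSum, Finset.mul_sum]
    refine Finset.sum_congr rfl fun q _ => ?_
    simp only [G, bilinMonomial, hu, hv]
    ring
  have hL : ∀ q, c q * (4 * x ^ (1 - 2 * (n + 1 : ℕ) : ℤ) *
        ((2 * q - j : ℝ) * ((n + 1 : ℕ) - q - (j + 1) / 2) *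
            (u ^ (2 * q - j - 1 : ℤ) * v ^ (2 * (n + 1 : ℕ) - 1 - 2 * q : ℤ)) +
          (2 * (n + 1 : ℕ) - 1 - 2 * q : ℝ) * (q - j) *
            (u ^ (2 * q - j : ℤ) * v ^ (2 * (n + 1 : ℕ) - 2 - 2 * q : ℤ)) +
          (2 * q - j : ℝ) * (2 * q - j - 1) / 2 *
            (u ^ (2 * q - j - 2 : ℤ) * v ^ (2 * (n + 1 : ℕ) - 2 * q : ℤ)) +
          (2 * (n + 1 : ℕ) - 1 - 2 * q : ℝ) * (2 * (n + 1 : ℕ) - 2 - 2 * q) / 2 *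
            (u ^ (2 * q - j + 1 : ℤ) * v ^ (2 * (n + 1 : ℕ) - 3 - 2 * q : ℤ)))) =
      4 * (x * x ^ (-(2 * (n + 1 : ℕ)) : ℤ)) * ((A q + E q) + (B q + C q)) := by
    intro q
    rw [hxz]
    simp only [A, B, C, E]
    ring
  refine (Finset.sum_congr rfl fun q _ => hL q).trans ?_
  beta_reduce
  rw [← Finset.mul_sum, Finset.sum_add_distrib,
    Finset.sum_add_distrib, Finset.sum_add_distrib, hBC, hAE, hS]
  ring

theorem nicholsonSum_zero {α : ℕ} (hα : 1 ≤ α) {y x : ℝ} :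
    nicholsonSum α 0 y x = (x ^ 2 - y) ^ (2 * α - 1) / x ^ (2 * α) := by
  rw [nicholsonSum, Finset.sum_eq_single_of_mem 0 (Finset.mem_range.mpr hα) fun q _ hq => by
    rw [nicholsonCoef_of_not (by omega), zero_mul]]
  rw [nicholsonCoef_eq α 0 0 (by ring) (by ring) (by ring), bilinMonomial,
    show (2 * α - 1 - 2 * (0 : ℕ) : ℤ) = (2 * α - 1 : ℕ) by omega, zpow_natCast, zpow_neg,
    show (2 * α : ℤ) = (2 * α : ℕ) by push_cast; ring, zpow_natCast]
  simp
  field_simp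

/-- **The particular solution of the inhomogeneous Bessel ODE** (Lemma `L4.3`).
For `α ≥ 1` and fixed `w > 0`, the function `z ↦ P(z,w)` satisfies, for all `z > 0`
with `z ≠ w`,
`z ∂²_z P + (2α+1) ∂_z P + z P = (α/(2^{2α-2} w^{2α})) ((z²-w²)/z)^{2α-1}`. -/
theorem nicholsonP_solves_inhomogeneous_ode
    (α : ℕ) (hα : 1 ≤ α) (w : ℝ) (hw : 0 < w)
    (z : ℝ) (hz : 0 < z) (hzw : z ≠ w) :
    z * deriv (deriv (fun x => nicholsonP α x w)) z
        + (2 * (α : ℝ) + 1) * deriv (fun x => nicholsonP α x w) z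
        + z * nicholsonP α z w
      = ((α : ℝ) / ((2 : ℝ) ^ (2 * (α : ℤ) - 2) * w ^ (2 * α))) *
          ((z ^ 2 - w ^ 2) / z) ^ (2 * α - 1) := by
  set K : ℝ := (α : ℝ) / (2 : ℝ) ^ (2 * (α : ℤ) - 2) with hK
  set y := w ^ 2 with hy
  have hy0 : 0 < y := by positivity
  have hgood : ∀ᶠ x in nhds z, 0 < x ∧ x ^ 2 ≠ y := by
    refine (eventually_gt_nhds hz).and ((continuous_pow 2).continuousAt.eventually_ne ?_)
    exact fun h => hzw ((sq_eq_sq₀ hz.le hw.le).mp h)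
  let g : ℝ → ℝ := fun x =>
    K / w ^ (2 * α) * ∑ j ∈ Finset.range α, aCoef α j * nicholsonSum α j y x
  have hPg : ∀ x, 0 < x ∧ x ^ 2 ≠ y → nicholsonP α x w = g x := by
    rintro x ⟨hx, hxy⟩
    have hT : ∑ j ∈ Finset.range α, aCoef α j * nicholsonT α j x w =
        (∑ j ∈ Finset.range α, aCoef α j * nicholsonSum α j y x) / w ^ (2 * α) := by
      rw [Finset.sum_div]
      refine Finset.sum_congr rfl fun j hj => ?_
      rw [nicholsonT_eq (Finset.mem_range.mp hj) hw hx hxy, mul_div_assoc]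
    rw [nicholsonP, hT, ← hK]
    simp only [g]
    ring
  obtain ⟨f', f'', H⟩ := (HasBesselOp.sum (Finset.range α) fun j hj =>
    (hasBesselOp_nicholsonSum hy0 (Finset.mem_range.mp hj)).const_mul (aCoef α j)).const_mul
      (K / w ^ (2 * α))
  have hd : deriv (fun x => nicholsonP α x w) =ᶠ[nhds z] f' := by
    filter_upwards [hgood.eventually_nhds] with x hx
    rw [Filter.EventuallyEq.deriv_eq (hx.mono hPg)]
    exact (H x hx.self_of_nhds.1 hx.self_of_nhds.2).1.deriv
  obtain ⟨-, h2, h3⟩ := H z hz hgood.self_of_nhds.2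
  rw [hd.deriv_eq, hd.self_of_nhds, h2.deriv, h3, hPg z hgood.self_of_nhds]
  have htel : ∑ j ∈ Finset.range α,
      (aCoef α (j + 1) * nicholsonSum α (j + 1) y z - aCoef α j * nicholsonSum α j y z) =
      -nicholsonSum α 0 y z := by
    rw [Finset.sum_range_sub fun j => aCoef α j * nicholsonSum α j y z]
    obtain ⟨n, rfl⟩ : ∃ n, α = n + 1 := ⟨α - 1, by omega⟩
    have h0 : aCoef (n + 1) (n + 1) = 0 := by simp [aCoef]
    rw [h0]
    simp [aCoef]
  have hsum : ∑ j ∈ Finset.range α, aCoef α j *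
        (-(2 * ((α : ℝ) - (j + 1))) * (z * nicholsonSum α (j + 1) y z)) =
      -z * ∑ j ∈ Finset.range α, aCoef α (j + 1) * nicholsonSum α (j + 1) y z := by
    rw [Finset.mul_sum]
    refine Finset.sum_congr rfl fun j _ => ?_
    rw [aCoef]
    ring
  rw [Finset.sum_sub_distrib, nicholsonSum_zero hα] at htel
  simp only [g]
  rw [hsum]
  have hz0 := hz.ne'
  have hzp : z ^ (2 * α) = z ^ (2 * α - 1) * z := by
    rw [← pow_succ]; congr 1; omega
  have hfin : z * ((z ^ 2 - y) ^ (2 * α - 1) / z ^ (2 * α)) = ((z ^ 2 - y) / z) ^ (2 * α - 1) := by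
    rw [hzp, div_pow]
    field_simp
  rw [← hfin, ← div_div, ← hK]
  linear_combination -(K / w ^ (2 * α)) * z * htel
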